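/- Let b > 0 and t₀ ∈ ℝ. There do not exist functions h, l : ℝ → ℝ with h(t₀) ≠ 0 such that for every t ∈ ℝ, h has derivative l(t)·h(t) at t and l has derivative b·h(t)² at t. In other words, the system (4.6): h' = l·h, l' = b·h² admits no solution defined on all of ℝ with h not identically vanishing. -/

import Mathlib

/-- A positive function with `l' ≥ k l²` for some `k > 0` cannot exist on a whole half-line. -/
theorem not_forall_mul_sq_le_deriv {l l' : ℝ → ℝ} {k t₀ : ℝ} (hk : 0 < k)
    (hl : ∀ t, t₀ ≤ t → 0 < l t) (hd : ∀ t, t₀ ≤ t → HasDerivAt l (l' t) t) :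
    ¬ ∀ t, t₀ ≤ t → k * l t ^ 2 ≤ l' t := by
  intro hle
  have hf : ∀ t, t₀ ≤ t →
      HasDerivAt (fun s => (l s)⁻¹ + k * s) (-l' t / l t ^ 2 + k * 1) t := fun t ht =>
    ((hd t ht).fun_inv (hl t ht).ne').add ((hasDerivAt_id t).const_mul k)
  have hanti : AntitoneOn (fun s => (l s)⁻¹ + k * s) (Set.Ici t₀) := by
    refine antitoneOn_of_hasDerivWithinAt_nonpos (convex_Ici t₀)
      (fun t ht => (hf t ht).continuousAt.continuousWithinAt)
      (fun t ht => (hf t (interior_subset ht)).hasDerivWithinAt) fun t ht => ?_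
    have ht' : t₀ ≤ t := interior_subset ht
    have : k ≤ l' t / l t ^ 2 := (le_div_iff₀ (pow_pos (hl t ht') 2)).2 (hle t ht')
    rw [neg_div]
    linarith
  have h₀ : 0 < l t₀ := hl t₀ le_rfl
  have hT : t₀ ≤ t₀ + (l t₀)⁻¹ / k := by
    have : 0 < (l t₀)⁻¹ / k := by positivity
    linarith
  have h := hanti Set.self_mem_Ici hT hT
  have hpos := inv_pos.2 (hl _ hT)
  have hcancel : k * ((l t₀)⁻¹ / k) = (l t₀)⁻¹ := mul_div_cancel₀ _ hk.ne'
  simp only [mul_add, hcancel] at h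
  linarith

/-- A monotone solution of the Riccati equation `l' = l² - c` that is positive with `c < l²` at
some time blows up in finite forward time. -/
theorem not_forall_hasDerivAt_sq_sub_of_pos {l : ℝ → ℝ} {c t₀ : ℝ} (hmono : Monotone l)
    (h₀ : 0 < l t₀) (hc : c < l t₀ ^ 2) :
    ¬ ∀ t, HasDerivAt l (l t ^ 2 - c) t := by
  intro hd
  have hlt : ∀ t, t₀ ≤ t → 0 < l t := fun t ht => h₀.trans_le (hmono ht)
  have hmax : max c 0 < l t₀ ^ 2 := max_lt hc (by positivity)
  have hk : 0 < 1 - max c 0 / l t₀ ^ 2 := by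
    rw [sub_pos, div_lt_one (by positivity)]
    exact hmax
  refine not_forall_mul_sq_le_deriv hk hlt (fun t _ => hd t) fun t ht => ?_
  have hsq : l t₀ ^ 2 ≤ l t ^ 2 := pow_le_pow_left₀ h₀.le (hmono ht) 2
  have hmul : max c 0 / l t₀ ^ 2 * l t₀ ^ 2 ≤ max c 0 / l t₀ ^ 2 * l t ^ 2 :=
    mul_le_mul_of_nonneg_left hsq (by positivity)
  rw [div_mul_cancel₀ _ (by positivity)] at hmul
  linarith [le_max_left c 0]

/-- A monotone solution of the Riccati equation `l' = l² - c` that is nonnegative with `c < l²` at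
some time blows up in finite forward time. -/
theorem not_forall_hasDerivAt_sq_sub_of_nonneg {l : ℝ → ℝ} {c t₀ : ℝ} (hmono : Monotone l)
    (h₀ : 0 ≤ l t₀) (hc : c < l t₀ ^ 2) :
    ¬ ∀ t, HasDerivAt l (l t ^ 2 - c) t := by
  intro hd
  rcases h₀.lt_or_eq with hpos | hzero
  · exact not_forall_hasDerivAt_sq_sub_of_pos hmono hpos hc hd
  have hneg : c < 0 := by simpa [← hzero] using hc
  have hmono' : Monotone fun t => l t - -c * t :=
    monotone_of_hasDerivAt_nonneg
      (fun t => (hd t).sub ((hasDerivAt_id t).const_mul (-c)))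
      fun t => by simp only [Pi.zero_apply]; nlinarith [sq_nonneg (l t)]
  have h := hmono' (le_add_of_nonneg_right zero_le_one : t₀ ≤ t₀ + 1)
  have hpos : 0 < l (t₀ + 1) := by
    simp only at h
    linarith
  exact not_forall_hasDerivAt_sq_sub_of_pos hmono hpos (hneg.trans (by positivity)) hd

/-- The analytic core of Proposition 4.2: the system (4.6) h' = l·h, l' = b·h² with
b > 0 admits no solution defined on all of ℝ with h not identically vanishing. -/
theorem system_no_global_solution (b t₀ : ℝ) (hb : 0 < b) :
    ¬ ∃ (h l : ℝ → ℝ), h t₀ ≠ 0 ∧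
      (∀ t : ℝ, HasDerivAt h (l t * h t) t) ∧
      (∀ t : ℝ, HasDerivAt l (b * h t ^ 2) t) := by
  rintro ⟨h, l, h₀, hh, hl⟩
  have hmono : Monotone l := monotone_of_hasDerivAt_nonneg hl fun t => by
    simp only [Pi.zero_apply]
    positivity
  obtain ⟨c, hc⟩ : ∃ c, ∀ t, l t ^ 2 - b * h t ^ 2 = c := by
    have hd : ∀ t, HasDerivAt (fun s => l s ^ 2 - b * h s ^ 2) 0 t := fun t => by
      refine (((hl t).fun_pow 2).fun_sub (((hh t).fun_pow 2).const_mul b)).congr_deriv ?_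
      push_cast
      ring
    exact ⟨_, fun t => is_const_of_deriv_eq_zero (fun s => (hd s).differentiableAt)
      (fun s => (hd s).deriv) t t₀⟩
  have hric : ∀ t, HasDerivAt l (l t ^ 2 - c) t := fun t => by
    simpa [← hc t] using hl t
  have hlt : c < l t₀ ^ 2 := by
    have : 0 < b * h t₀ ^ 2 := by positivity
    linarith [hc t₀]
  rcases le_total 0 (l t₀) with hnn | hnp
  · exact not_forall_hasDerivAt_sq_sub_of_nonneg hmono hnn hlt hric
  · refine not_forall_hasDerivAt_sq_sub_of_nonneg (l := fun t => -l (-t)) (t₀ := -t₀) (c := c)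
      (fun x y hxy => neg_le_neg (hmono (neg_le_neg hxy))) (by simpa using hnp)
      (by simpa using hlt) fun t => ?_
    exact ((hric (-t)).scomp t (hasDerivAt_neg t)).neg.congr_deriv (by simp)
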